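/- Consider a network: a finite directed acyclic multigraph (V, E, tail, head) (acyclicity witnessed by an injection ord : E → ℕ with ord(d) < ord(e) whenever head(d) = tail(e)), distinct source nodes σ_1, …, σ_s (s ≥ 1) with no incoming edges, each having a path to the sink node ρ ∉ {σ_1, …, σ_s}, which has no outgoing edges. Let F be a finite field, ℓ, n ≥ 1, and 𝒦_1, …, 𝒦_s finite nonempty sets; let (M, K) = ((M_1, …, M_s), (K_1, …, K_s)) be uniformly distributed on (F^ℓ)^s × Π_i 𝒦_i. Let (g_e)_{e∈E}, g_e : (F^ℓ)^s × Π_i 𝒦_i → F^n, satisfy: if tail(e) = σ_i then g_e(m, k) depends only on (m_i, k_i); otherwise g_e(m, k) = θ_e((g_d(m, k))_{d ∈ In(tail(e))}) for some θ_e. Let r ∈ ℕ with r ≤ C_min. Then the following are equivalent: (a) for every W ⊆ E with |W| ≤ r, the random variables (g_e(M, K))_{e∈W} and Σ_{i=1}^s M_i are independent; (b) for every W ∈ 𝒲_r* (the collection of primary edge sets of size exactly r), the random variables (g_e(M, K))_{e∈W} and Σ_{i=1}^s M_i are independent. -/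

import Mathlib

noncomputable section

/-- Every type is endowed with the `⊤` σ-algebra (every set measurable), the usual choice
for finite sample spaces. -/
local instance (priority := high) topMeasurableSpace (α : Type _) : MeasurableSpace α := ⊤

open ProbabilityTheory

/-- A (directed) path starting at the node `u` and ending at the edge `e`. -/
def IsPathToEdge {V E : Type} (tail head : E → V) (u : V) (p : List E) (e : E) : Prop :=
  (∃ d, p.head? = some d ∧ tail d = u) ∧
    List.Chain' (fun d e' => head d = tail e') p ∧ p.getLast? = some e

/-- A (directed) path from the node `u` to the node `v`. -/
def IsPathToNode {V E : Type} (tail head : E → V) (u : V) (p : List E) (v : V) : Prop :=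
  (∃ d, p.head? = some d ∧ tail d = u) ∧
    List.Chain' (fun d e' => head d = tail e') p ∧
    (∃ d, p.getLast? = some d ∧ head d = v)

/-- `D_W` (as a set of source indices): sources from which some edge of `W` can be reached. -/
def Didx {V E : Type} {s : ℕ} (tail head : E → V) (σ : Fin s → V) (W : Set E) :
    Set (Fin s) :=
  {i | ∃ e ∈ W, ∃ p : List E, IsPathToEdge tail head (σ i) p e}

/-- `I_C` (as a set of source indices): sources `σ_i` such that every path from `σ_i` to the
sink `ρ` contains an edge of `C`. -/
def Iidx {V E : Type} {s : ℕ} (tail head : E → V) (σ : Fin s → V) (ρ : V) (C : Set E) :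
    Set (Fin s) :=
  {i | ∀ p : List E, IsPathToNode tail head (σ i) p ρ → ∃ e ∈ p, e ∈ C}

/-- An edge set `W'` separates the edge set `W` from the set `U` of source indices: every
path from a source of `U` to an edge of `W` contains an edge of `W'`. -/
def Separates {V E : Type} {s : ℕ} (tail head : E → V) (σ : Fin s → V)
    (W' : Set E) (U : Set (Fin s)) (W : Set E) : Prop :=
  ∀ i ∈ U, ∀ e ∈ W, ∀ p : List E, IsPathToEdge tail head (σ i) p e → ∃ c ∈ p, c ∈ W'

/-- `mincut(U, W)`: the minimum cardinality of an edge set separating `W` from `U`. -/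
noncomputable def mincutUW {V E : Type} [Fintype E] {s : ℕ} (tail head : E → V)
    (σ : Fin s → V) (U : Set (Fin s)) (W : Set E) : ℕ :=
  sInf {n | ∃ W' : Finset E, Separates tail head σ ↑W' U W ∧ W'.card = n}

/-- `W` is primary: `W` is a minimum cut separating `W` itself from `D_W`, and it separates
from `D_W` every minimum cut separating `W` from `D_W`. -/
def IsPrimary {V E : Type} [Fintype E] {s : ℕ} (tail head : E → V) (σ : Fin s → V)
    (W : Finset E) : Prop :=
  Separates tail head σ ↑W (Didx tail head σ ↑W) ↑W ∧
  W.card = mincutUW tail head σ (Didx tail head σ ↑W) ↑W ∧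
  ∀ W' : Finset E, Separates tail head σ ↑W' (Didx tail head σ ↑W) ↑W →
    W'.card = mincutUW tail head σ (Didx tail head σ ↑W) ↑W →
    Separates tail head σ ↑W (Didx tail head σ ↑W) ↑W'

/-- `mincut(σ_i, ρ) = min{|C| : σ_i ∈ I_C}`. -/
noncomputable def mincutIdx {V E : Type} [Fintype E] {s : ℕ} (tail head : E → V)
    (σ : Fin s → V) (ρ : V) (i : Fin s) : ℕ :=
  sInf {n | ∃ C : Finset E, i ∈ Iidx tail head σ ρ ↑C ∧ C.card = n}

/-- `C_min = min_i mincut(σ_i, ρ)`. -/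
noncomputable def CminIdx {V E : Type} [Fintype E] {s : ℕ} (tail head : E → V)
    (σ : Fin s → V) (ρ : V) : ℕ :=
  sInf {n | ∃ i : Fin s, n = mincutIdx tail head σ ρ i}

section SeparatingCuts

variable {V E : Type} {s : ℕ} {tail head : E → V} {σ : Fin s → V}

theorem isPathToEdge_singleton {u : V} {e : E} (h : tail e = u) :
    IsPathToEdge tail head u [e] e :=
  ⟨⟨e, rfl, h⟩, List.isChain_singleton e, rfl⟩

theorem IsPathToEdge.concat {u : V} {p : List E} {d e : E}
    (hp : IsPathToEdge tail head u p d) (hde : head d = tail e) :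
    IsPathToEdge tail head u (p ++ [e]) e := by
  obtain ⟨⟨a, ha, hau⟩, hc, hl⟩ := hp
  refine ⟨⟨a, by simp [List.head?_append, ha], hau⟩, ?_, by simp⟩
  refine List.isChain_append.2 ⟨hc, List.isChain_singleton e, ?_⟩
  intro x hx y hy
  simp_all

theorem IsPathToEdge.exists_prefix {u : V} {p : List E} {e c : E}
    (hp : IsPathToEdge tail head u p e) (hc : c ∈ p) :
    ∃ q : List E, IsPathToEdge tail head u q c ∧ ∀ x ∈ q, x ∈ p := by
  obtain ⟨a, b, rfl⟩ := List.append_of_mem hc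
  obtain ⟨⟨d, hd, hdu⟩, hch, -⟩ := hp
  refine ⟨a ++ [c], ⟨⟨d, ?_, hdu⟩, ?_, by simp⟩, by aesop⟩
  · cases a <;> simpa using hd
  · have h : a ++ c :: b = (a ++ [c]) ++ b := by simp
    rw [h] at hch
    exact (List.isChain_append.1 hch).1

/-- The edges separated by `C` from all sources. -/
def blockedEdges (tail head : E → V) (σ : Fin s → V) (C : Set E) : Set E :=
  {e | ∀ i p, IsPathToEdge tail head (σ i) p e → ∃ c ∈ p, c ∈ C}

theorem subset_blockedEdges (C : Set E) : C ⊆ blockedEdges tail head σ C :=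
  fun e he _ _ hp => ⟨e, List.mem_of_getLast? hp.2.2, he⟩

theorem blockedEdges_mono {C C' : Set E} (h : C ⊆ C') :
    blockedEdges tail head σ C ⊆ blockedEdges tail head σ C' :=
  fun _ he i p hp => (he i p hp).imp fun _ hc => ⟨hc.1, h hc.2⟩

theorem blockedEdges_subset {C C' : Set E} (h : C ⊆ blockedEdges tail head σ C') :
    blockedEdges tail head σ C ⊆ blockedEdges tail head σ C' := by
  intro e he i p hp
  obtain ⟨c, hcp, hcC⟩ := he i p hp
  obtain ⟨q, hq, hqp⟩ := hp.exists_prefix hcp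
  obtain ⟨c', hc', hC'⟩ := h hcC i q hq
  exact ⟨c', hqp _ hc', hC'⟩

theorem Separates.subset_blockedEdges {C W : Set E}
    (h : Separates tail head σ C (Didx tail head σ W) W) :
    W ⊆ blockedEdges tail head σ C :=
  fun e he i p hp => h i ⟨e, he, p, hp⟩ e he p hp

theorem separates_of_subset_blockedEdges {C W : Set E} {U : Set (Fin s)}
    (h : W ⊆ blockedEdges tail head σ C) : Separates tail head σ C U W :=
  fun i _ _ he p hp => h he i p hp

theorem eq_of_mem_blockedEdges {Ω β : Type} {ord : E → ℕ}
    (hDAG : ∀ d e : E, head d = tail e → ord d < ord e) {g : E → Ω → β}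
    (hrelay : ∀ e : E, tail e ∉ Set.range σ →
      ∃ θ : ({d : E // head d = tail e} → β) → β, ∀ x, g e x = θ (fun d => g d.1 x))
    {C : Set E} {x y : Ω} (hC : ∀ c ∈ C, g c x = g c y) (e : E)
    (he : e ∈ blockedEdges tail head σ C) : g e x = g e y := by
  induction hk : ord e using Nat.strong_induction_on generalizing e with
  | _ k ih =>
    subst hk
    by_cases heC : e ∈ C
    · exact hC e heC
    · have htail : tail e ∉ Set.range σ := by
        rintro ⟨i, hi⟩
        obtain ⟨c, hc, hcC⟩ := he i [e] (isPathToEdge_singleton hi.symm)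
        rw [List.mem_singleton] at hc
        exact heC (hc ▸ hcC)
      obtain ⟨θ, hθ⟩ := hrelay e htail
      rw [hθ, hθ]
      congr 1
      funext ⟨d, hd⟩
      refine ih _ (hDAG d e hd) d ?_ rfl
      intro i p hp
      obtain ⟨c, hc, hcC⟩ := he i _ (hp.concat hd)
      rcases List.mem_append.1 hc with hc | hc
      · exact ⟨c, hc, hcC⟩
      · rw [List.mem_singleton] at hc
        exact absurd (hc ▸ hcC) heC

theorem CminIdx_le_card [Fintype E] (hs : 1 ≤ s) {ρ : V} {C : Finset E}
    (hC : blockedEdges tail head σ (C : Set E) = Set.univ) :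
    CminIdx tail head σ ρ ≤ C.card := by
  have h : CminIdx tail head σ ρ ≤ mincutIdx tail head σ ρ ⟨0, hs⟩ := Nat.sInf_le ⟨_, rfl⟩
  refine h.trans (Nat.sInf_le ⟨C, ?_, rfl⟩)
  rintro p ⟨hh, hc, d, hd, -⟩
  exact (hC ▸ Set.mem_univ d : d ∈ blockedEdges tail head σ (C : Set E)) _ p ⟨hh, hc, hd⟩

theorem exists_ssubset_blockedEdges [Fintype E] (hs : 1 ≤ s) {ρ : V} {C : Finset E}
    (hC : C.card < CminIdx tail head σ ρ) :
    ∃ C' : Finset E, C'.card ≤ C.card + 1 ∧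
      blockedEdges tail head σ (C : Set E) ⊂ blockedEdges tail head σ (C' : Set E) := by
  classical
  have hne : blockedEdges tail head σ (C : Set E) ≠ Set.univ :=
    fun h => (CminIdx_le_card hs h).not_gt hC
  obtain ⟨e, he⟩ := (Set.ne_univ_iff_exists_notMem _).1 hne
  refine ⟨insert e C, Finset.card_insert_le _ _, ?_⟩
  refine (Set.ssubset_iff_of_subset (blockedEdges_mono (by simp))).2
    ⟨e, subset_blockedEdges _ (by simp), he⟩

/-- Every edge set of size at most `r ≤ C_min` is separated from all sources by a primary
edge set of size `r`. -/
theorem exists_isPrimary_subset_blockedEdges [Fintype E] (hs : 1 ≤ s) {ρ : V} {r : ℕ}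
    (hr : r ≤ CminIdx tail head σ ρ) {W : Finset E} (hW : W.card ≤ r) :
    ∃ C : Finset E, C.card = r ∧ IsPrimary tail head σ C ∧
      (W : Set E) ⊆ blockedEdges tail head σ (C : Set E) := by
  classical
  let B : Finset E → Set E := fun C => blockedEdges tail head σ (C : Set E)
  obtain ⟨C, hCmem, hmax⟩ := Set.Finite.exists_maximalFor B
    {C : Finset E | C.card ≤ r ∧ (W : Set E) ⊆ B C} (Set.toFinite _)
    ⟨W, hW, subset_blockedEdges _⟩
  obtain ⟨hCr, hWC⟩ : C.card ≤ r ∧ (W : Set E) ⊆ B C := hCmem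
  have hle : ∀ C' : Finset E, C'.card ≤ r → B C ⊆ B C' → B C' ⊆ B C :=
    fun C' h1 h2 => hmax ⟨h1, hWC.trans h2⟩ h2
  have hcard : ∀ C' : Finset E, B C ⊆ B C' → r ≤ C'.card := by
    intro C' h
    by_contra! hlt
    obtain ⟨C'', h1, h2⟩ := exists_ssubset_blockedEdges hs (hlt.trans_le hr)
    exact h2.not_subset ((hle C'' (by omega) (h.trans h2.subset)).trans h)
  have hCeq : C.card = r := le_antisymm hCr (hcard C subset_rfl)
  have hcut : C.card = mincutUW tail head σ (Didx tail head σ ↑C) ↑C := by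
    refine le_antisymm (le_csInf ?_ ?_) (Nat.sInf_le ?_)
    · exact ⟨_, C, separates_of_subset_blockedEdges (subset_blockedEdges _), rfl⟩
    · rintro _ ⟨C', hsep, rfl⟩
      exact hCeq.trans_le (hcard C' (blockedEdges_subset hsep.subset_blockedEdges))
    · exact ⟨C, separates_of_subset_blockedEdges (subset_blockedEdges _), rfl⟩
  refine ⟨C, hCeq, ⟨separates_of_subset_blockedEdges (subset_blockedEdges _), hcut, ?_⟩, hWC⟩
  intro C' hsep hC'
  refine separates_of_subset_blockedEdges ((subset_blockedEdges _).trans (hle C' ?_ ?_))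
  · omega
  · exact blockedEdges_subset hsep.subset_blockedEdges

end SeparatingCuts

/-- Theorem 8: for a function-computing network code on a DAG with security level
`r ≤ C_min`, target-function security against all wiretap sets of size at most `r` is
equivalent to target-function security against the reduced collection `𝒲_r*` of primary
edge sets of size exactly `r`. -/
theorem security_iff_security_primary
    {V E : Type} [Fintype V] [Fintype E] (tail head : E → V)
    (ord : E → ℕ) (hord : Function.Injective ord)
    (hDAG : ∀ d e : E, head d = tail e → ord d < ord e)
    {s : ℕ} (hs : 1 ≤ s) (σ : Fin s → V) (hσ : Function.Injective σ)
    (ρ : V) (hρ : ρ ∉ Set.range σ)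
    (hNoIn : ∀ (e : E) (i : Fin s), head e ≠ σ i)
    (hNoOut : ∀ e : E, tail e ≠ ρ)
    (hpath : ∀ i : Fin s, ∃ p : List E, IsPathToNode tail head (σ i) p ρ)
    {F : Type} [Field F] [Fintype F] [DecidableEq F]
    (l n : ℕ) (hl : 1 ≤ l) (hn : 1 ≤ n)
    (r : ℕ) (hr : r ≤ CminIdx tail head σ ρ)
    (𝒦 : Fin s → Type) [∀ i, Fintype (𝒦 i)] [∀ i, Nonempty (𝒦 i)]
    (g : E → (Fin s → Fin l → F) × ((i : Fin s) → 𝒦 i) → (Fin n → F))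
    (hsrc : ∀ (e : E) (i : Fin s), tail e = σ i →
      ∃ θ : (Fin l → F) × 𝒦 i → (Fin n → F), ∀ m k, g e (m, k) = θ (m i, k i))
    (hrelay : ∀ e : E, tail e ∉ Set.range σ →
      ∃ θ : ({d : E // head d = tail e} → (Fin n → F)) → (Fin n → F),
        ∀ x, g e x = θ (fun d => g d.1 x)) :
    (∀ W : Finset E, W.card ≤ r →
      IndepFun
        (fun ω : (Fin s → Fin l → F) × ((i : Fin s) → 𝒦 i) =>
          (fun e : {e : E // e ∈ W} => g e.1 ω))
        (fun ω : (Fin s → Fin l → F) × ((i : Fin s) → 𝒦 i) => ∑ i, ω.1 i)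
        (PMF.uniformOfFintype ((Fin s → Fin l → F) × ((i : Fin s) → 𝒦 i))).toMeasure) ↔
    (∀ W : Finset E, W.card = r → IsPrimary tail head σ W →
      IndepFun
        (fun ω : (Fin s → Fin l → F) × ((i : Fin s) → 𝒦 i) =>
          (fun e : {e : E // e ∈ W} => g e.1 ω))
        (fun ω : (Fin s → Fin l → F) × ((i : Fin s) → 𝒦 i) => ∑ i, ω.1 i)
        (PMF.uniformOfFintype ((Fin s → Fin l → F) × ((i : Fin s) → 𝒦 i))).toMeasure) := by
  refine ⟨fun h W hW _ => h W hW.le, fun h W hW => ?_⟩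
  obtain ⟨C, hCr, hprim, hWC⟩ := exists_isPrimary_subset_blockedEdges hs hr hW
  have hfac : Function.FactorsThrough
      (fun (ω : (Fin s → Fin l → F) × ((i : Fin s) → 𝒦 i)) (e : {e : E // e ∈ W}) => g e.1 ω)
      (fun ω (e : {e : E // e ∈ C}) => g e.1 ω) := by
    intro x y hxy
    funext e
    exact eq_of_mem_blockedEdges hDAG hrelay (fun c hc => congrFun hxy ⟨c, hc⟩) e.1 (hWC e.2)
  obtain ⟨φ, hφ⟩ := (Function.factorsThrough_iff _).1 hfac
  rw [hφ]
  exact (h C hCr hprim).comp measurable_from_top measurable_id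

end
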